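/- If φ₁ and φ₂ are generalized Calabi–Yau structures on vector spaces V₁ and V₂ with projections p₁, p₂ from V₁ ⊕ V₂, then p₁*φ₁ ∧ p₂*φ₂ is a generalized Calabi–Yau structure on V₁ ⊕ V₂, and type(p₁*φ₁ ∧ p₂*φ₂) = type(φ₁) + type(φ₂). -/

import Mathlib

set_option synthInstance.maxHeartbeats 1000000
set_option maxHeartbeats 1000000
set_option maxSynthPendingDepth 3

open Module LinearMap TensorProduct

noncomputable section

variable (𝕜 : Type*) [Field 𝕜] (V : Type*) [AddCommGroup V] [Module 𝕜 V]

abbrev Sp := ExteriorAlgebra 𝕜 (Module.Dual 𝕜 V)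

def gAct : (V × Module.Dual 𝕜 V) →ₗ[𝕜] Module.End 𝕜 (Sp 𝕜 V) :=
  (CliffordAlgebra.contractLeft (Q := (0 : QuadraticForm 𝕜 (Module.Dual 𝕜 V)))).comp
      ((Module.Dual.eval 𝕜 V).comp (LinearMap.fst 𝕜 V (Module.Dual 𝕜 V)))
    + (LinearMap.mul 𝕜 (Sp 𝕜 V)).comp
      ((ExteriorAlgebra.ι 𝕜).comp (LinearMap.snd 𝕜 V (Module.Dual 𝕜 V)))

def gProj (n : ℕ) : Sp 𝕜 V →ₗ[𝕜] Sp 𝕜 V :=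
  (Submodule.subtype _).comp
    ((DirectSum.component 𝕜 ℕ _ n).comp
      (DirectSum.decomposeLinearEquiv (fun i : ℕ => ⋀[𝕜]^i (Module.Dual 𝕜 V))).toLinearMap)

variable (W : Type*) [AddCommGroup W] [Module ℝ W]

/-- complex spinors on a real vector space `W`: `Λ W* ⊗ ℂ` -/
abbrev SpC := ℂ ⊗[ℝ] Sp ℝ W

/-- complex conjugation on `Λ W* ⊗ ℂ` -/
def conjSC : SpC W →ₗ[ℝ] SpC W :=
  TensorProduct.map Complex.conjAe.toLinearMap LinearMap.id

/-- the anti-automorphism `σ` reversing wedge factors, on `Λ W* ⊗ ℂ` -/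
def revSC : SpC W →ₗ[ℂ] SpC W :=
  LinearMap.baseChange ℂ (CliffordAlgebra.reverse (Q := (0 : QuadraticForm ℝ (Module.Dual ℝ W))))

/-- degree-`n` projection on `Λ W* ⊗ ℂ` -/
def projSC (n : ℕ) : SpC W →ₗ[ℂ] SpC W :=
  LinearMap.baseChange ℂ (gProj ℝ W n)

/-- spinor pairing `⟨φ,ψ⟩ = (σ(φ) ∧ ψ)ₙ` on `Λ W* ⊗ ℂ` -/
def pairSC (n : ℕ) (φ ψ : SpC W) : SpC W := projSC W n (revSC W φ * ψ)

/-- complexified Clifford action of `(W ⊕ W*) ⊗ ℂ` on `Λ W* ⊗ ℂ` -/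
def actC : (ℂ ⊗[ℝ] (W × Module.Dual ℝ W)) →ₗ[ℂ] (SpC W →ₗ[ℂ] SpC W) :=
  LinearMap.liftBaseChange ℂ
    ((LinearMap.baseChangeHom ℝ ℂ (Sp ℝ W) (Sp ℝ W)).comp (gAct ℝ W))

/-- annihilator of a complex spinor inside `(W ⊕ W*) ⊗ ℂ` -/
def annC (φ : SpC W) : Submodule ℂ (ℂ ⊗[ℝ] (W × Module.Dual ℝ W)) :=
  LinearMap.ker ((actC W).flip φ)

/-- truncated exponential in `Λ W* ⊗ ℂ` -/
def expC (n : ℕ) (B : SpC W) : SpC W :=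
  ∑ k ∈ Finset.range (n + 1), (k.factorial : ℂ)⁻¹ • B ^ k

/-- a generalized Calabi–Yau structure on the `n`-dimensional space `W`:
a complex pure spinor `φ` with `⟨φ, φ̄⟩ ≠ 0` -/
def IsGCY [FiniteDimensional ℝ W] (φ : SpC W) : Prop :=
  Module.finrank ℂ (annC W φ) = Module.finrank ℝ W ∧
    pairSC W (Module.finrank ℝ W) φ (conjSC W φ) ≠ 0

/-- the type of a complex spinor: the lowest degree in which it has a nonzero component -/
def typeOf (φ : SpC W) : ℕ := sInf {k : ℕ | projSC W k φ ≠ 0}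

/-- pullback of complex forms along a linear map `f : W₁ → W₂`
(the algebra map `Λ W₂* ⊗ ℂ → Λ W₁* ⊗ ℂ` induced by the transpose of `f`) -/
def pbC (W₁ W₂ : Type*) [AddCommGroup W₁] [Module ℝ W₁] [AddCommGroup W₂] [Module ℝ W₂]
    (f : W₁ →ₗ[ℝ] W₂) : SpC W₂ →ₐ[ℂ] SpC W₁ :=
  Algebra.TensorProduct.map (AlgHom.id ℂ ℂ)
    (ExteriorAlgebra.map (Module.Dual.transpose (R := ℝ) f))

section ExteriorAlgebraLemmas

open CliffordAlgebra in
theorem ExteriorAlgebra.contractLeft_mul {R M : Type*} [CommRing R] [AddCommGroup M] [Module R M]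
    (d : Module.Dual R M) (x y : ExteriorAlgebra R M) :
    contractLeft (Q := (0 : QuadraticForm R M)) d (x * y) =
      contractLeft (Q := (0 : QuadraticForm R M)) d x * y +
        involute (Q := (0 : QuadraticForm R M)) x *
          contractLeft (Q := (0 : QuadraticForm R M)) d y := by
  induction x using CliffordAlgebra.left_induction with
  | algebraMap r => simp [← Algebra.smul_def]
  | add a b ha hb => simp only [add_mul, map_add, ha, hb]; abel
  | ι_mul a m ha =>
    simp only [mul_assoc, contractLeft_ι_mul, ha, map_mul, involute_ι, mul_add, sub_mul,
      smul_mul_assoc, neg_mul]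
    abel

open CliffordAlgebra in
theorem ExteriorAlgebra.contractLeft_map {R M N : Type*} [CommRing R] [AddCommGroup M] [Module R M]
    [AddCommGroup N] [Module R N] (f : M →ₗ[R] N) (d : Module.Dual R N)
    (x : ExteriorAlgebra R M) :
    contractLeft (Q := (0 : QuadraticForm R N)) d (ExteriorAlgebra.map f x) =
      ExteriorAlgebra.map f (contractLeft (Q := (0 : QuadraticForm R M)) (d ∘ₗ f) x) := by
  induction x using CliffordAlgebra.left_induction with
  | algebraMap r => simp
  | add a b ha hb => simp only [map_add, ha, hb]
  | ι_mul a m ha =>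
    have h : ExteriorAlgebra.map f (CliffordAlgebra.ι 0 m) = CliffordAlgebra.ι 0 (f m) :=
      ExteriorAlgebra.map_apply_ι f m
    simp only [map_mul, contractLeft_ι_mul, ha, h, map_sub, map_smul, LinearMap.comp_apply]

open CliffordAlgebra in
theorem ExteriorAlgebra.ι_mul_eq_involute_mul {R M : Type*} [CommRing R] [AddCommGroup M]
    [Module R M] (m : M) (x : ExteriorAlgebra R M) :
    ExteriorAlgebra.ι R m * x =
      involute (Q := (0 : QuadraticForm R M)) x * ExteriorAlgebra.ι R m := by
  induction x using ExteriorAlgebra.induction with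
  | algebraMap r => simp [Algebra.commutes]
  | ι a =>
    have h : involute (Q := (0 : QuadraticForm R M)) (ExteriorAlgebra.ι R a) =
      - ExteriorAlgebra.ι R a := involute_ι a
    rw [h, neg_mul]
    exact eq_neg_of_add_eq_zero_left (ExteriorAlgebra.ι_add_mul_swap m a)
  | mul a b ha hb => rw [← mul_assoc, ha, mul_assoc, hb, map_mul, mul_assoc]
  | add a b ha hb => simp only [map_add, mul_add, add_mul, ha, hb]

open CliffordAlgebra in
theorem ExteriorAlgebra.involute_map {R M N : Type*} [CommRing R] [AddCommGroup M] [Module R M]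
    [AddCommGroup N] [Module R N] (f : M →ₗ[R] N) (x : ExteriorAlgebra R M) :
    involute (Q := (0 : QuadraticForm R N)) (ExteriorAlgebra.map f x) =
      ExteriorAlgebra.map f (involute (Q := (0 : QuadraticForm R M)) x) := by
  have h : (involute (Q := (0 : QuadraticForm R N))).comp (ExteriorAlgebra.map f) =
      (ExteriorAlgebra.map f).comp (involute (Q := (0 : QuadraticForm R M))) := by
    apply ExteriorAlgebra.hom_ext
    ext m
    have h1 := involute_ι (Q := (0 : QuadraticForm R M)) m
    have h2 := involute_ι (Q := (0 : QuadraticForm R N)) (f m)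
    have h3 := ExteriorAlgebra.map_apply_ι f m
    simp only [ExteriorAlgebra.ι] at *
    simp [h1, h2, h3]
  exact DFunLike.congr_fun h x

open CliffordAlgebra in
theorem ExteriorAlgebra.reverse_map {R M N : Type*} [CommRing R] [AddCommGroup M] [Module R M]
    [AddCommGroup N] [Module R N] (f : M →ₗ[R] N) (x : ExteriorAlgebra R M) :
    reverse (Q := (0 : QuadraticForm R N)) (ExteriorAlgebra.map f x) =
      ExteriorAlgebra.map f (reverse (Q := (0 : QuadraticForm R M)) x) := by
  induction x using CliffordAlgebra.left_induction with
  | algebraMap r => simp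
  | add a b ha hb => simp only [map_add, ha, hb]
  | ι_mul a m ha =>
    have h : ExteriorAlgebra.map f (CliffordAlgebra.ι 0 m) = CliffordAlgebra.ι 0 (f m) :=
      ExteriorAlgebra.map_apply_ι f m
    simp only [map_mul, CliffordAlgebra.reverse.map_mul, ha, h, reverse_ι]

open CliffordAlgebra in
theorem ExteriorAlgebra.reverse_contractLeft {R M : Type*} [CommRing R] [AddCommGroup M]
    [Module R M] (d : Module.Dual R M) (x : ExteriorAlgebra R M) :
    reverse (contractLeft (Q := (0 : QuadraticForm R M)) d x) =
      -contractLeft (Q := (0 : QuadraticForm R M)) d (involute (reverse x)) := by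
  induction x using CliffordAlgebra.left_induction with
  | algebraMap r => simp
  | add a b ha hb => simp only [map_add, ha, hb, neg_add]
  | ι_mul a m ha =>
    have h := ExteriorAlgebra.contractLeft_mul d
      (involute (Q := (0 : QuadraticForm R M)) (reverse a)) (CliffordAlgebra.ι 0 m)
    rw [contractLeft_ι, involute_involute] at h
    rw [contractLeft_ι_mul, CliffordAlgebra.reverse.map_mul, map_sub, map_smul,
      CliffordAlgebra.reverse.map_mul, map_mul, reverse_ι, involute_ι, mul_neg, map_neg, neg_neg,
      h, ha, ← Algebra.commutes, ← Algebra.smul_def]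
    rw [neg_mul, sub_neg_eq_add, add_comm]

end ExteriorAlgebraLemmas

section Grading

variable {K U U' : Type*} [Field K] [AddCommGroup U] [Module K U] [AddCommGroup U'] [Module K U']

theorem gProj_mem (n : ℕ) (x : Sp K U) : gProj K U n x ∈ ⋀[K]^n (Module.Dual K U) :=
  Subtype.property _

theorem gProj_of_mem {i : ℕ} {x : Sp K U} (hx : x ∈ ⋀[K]^i (Module.Dual K U)) (n : ℕ) :
    gProj K U n x = if i = n then x else 0 := by
  have h : gProj K U n x =
      DirectSum.decompose (fun i : ℕ => ⋀[K]^i (Module.Dual K U)) x n := rfl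
  rw [h]
  split_ifs with hi
  · subst hi
    exact DirectSum.decompose_of_mem_same _ hx
  · exact DirectSum.decompose_of_mem_ne _ hx hi

theorem sum_gProj (s : Finset ℕ) (hs : ∀ n ∉ s, ∀ x : Sp K U, gProj K U n x = 0) (x : Sp K U) :
    ∑ n ∈ s, gProj K U n x = x := by
  classical
  induction x using DirectSum.Decomposition.inductionOn
    (fun i : ℕ => ⋀[K]^i (Module.Dual K U)) with
  | zero => simp
  | @homogeneous i a =>
    simp only [gProj_of_mem a.2, Finset.sum_ite_eq]
    split_ifs with h
    · rfl
    · rw [← hs i h a, gProj_of_mem a.2, if_pos rfl]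
  | add a b ha hb => simp only [map_add, Finset.sum_add_distrib, ha, hb]

theorem gProj_mul (n : ℕ) (x y : Sp K U) :
    gProj K U n (x * y) =
      ∑ p ∈ Finset.HasAntidiagonal.antidiagonal n, gProj K U p.1 x * gProj K U p.2 y := by
  classical
  induction x using DirectSum.Decomposition.inductionOn
    (fun i : ℕ => ⋀[K]^i (Module.Dual K U)) with
  | zero => simp
  | add a b ha hb => simp only [map_add, add_mul, Finset.sum_add_distrib, ha, hb]
  | @homogeneous i a =>
    induction y using DirectSum.Decomposition.inductionOn
      (fun i : ℕ => ⋀[K]^i (Module.Dual K U)) with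
    | zero => simp
    | add a b ha hb => simp only [map_add, mul_add, Finset.sum_add_distrib, ha, hb]
    | @homogeneous j b =>
      rw [gProj_of_mem (SetLike.mul_mem_graded a.2 b.2)]
      simp only [gProj_of_mem a.2, gProj_of_mem b.2, ite_mul, mul_ite, zero_mul, mul_zero,
        ← ite_and]
      rw [Finset.sum_congr rfl (g := fun p => if p = (i, j) then (a * b : Sp K U) else 0)]
      · rw [Finset.sum_ite_eq']
        simp
      · intro p _
        congr 1
        simp only [Prod.ext_iff, eq_iff_iff]
        tauto

theorem gProj_eq_zero [FiniteDimensional K U] {n : ℕ} (hn : Module.finrank K U < n) (x : Sp K U) :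
    gProj K U n x = 0 := by
  have h : Module.finrank K (⋀[K]^n (Module.Dual K U)) = 0 := by
    rw [exteriorPower.finrank_eq, Subspace.dual_finrank_eq, Nat.choose_eq_zero_of_lt hn]
  have := Module.finrank_zero_iff.1 h
  have h0 := Subsingleton.elim
    (⟨gProj K U n x, gProj_mem n x⟩ : ⋀[K]^n (Module.Dual K U)) 0
  exact congrArg Subtype.val h0

theorem gProj_map (f : Module.Dual K U →ₗ[K] Module.Dual K U') (n : ℕ) (x : Sp K U) :
    gProj K U' n (ExteriorAlgebra.map f x) = ExteriorAlgebra.map f (gProj K U n x) := by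
  induction x using DirectSum.Decomposition.inductionOn
    (fun i : ℕ => ⋀[K]^i (Module.Dual K U)) with
  | zero => simp
  | add a b ha hb => simp only [map_add, ha, hb]
  | @homogeneous i a =>
    have h : ExteriorAlgebra.map f (a : Sp K U) ∈ ⋀[K]^i (Module.Dual K U') := by
      have h1 : ExteriorAlgebra.map f (a : Sp K U) ∈
          Submodule.map (ExteriorAlgebra.map f).toLinearMap (⋀[K]^i (Module.Dual K U)) :=
        Submodule.mem_map_of_mem a.2
      rw [Submodule.map_pow, ExteriorAlgebra.ι_range_map_map] at h1
      exact pow_le_pow_left' LinearMap.map_le_range i h1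
    rw [gProj_of_mem h, gProj_of_mem a.2]
    split_ifs <;> simp

theorem gProj_contractLeft (d : Module.Dual K (Module.Dual K U)) (n : ℕ) (x : Sp K U) :
    gProj K U n (CliffordAlgebra.contractLeft (Q := (0 : QuadraticForm K (Module.Dual K U))) d x) =
      CliffordAlgebra.contractLeft (Q := (0 : QuadraticForm K (Module.Dual K U))) d
        (gProj K U (n + 1) x) := by
  have hscal (r : K) (k : ℕ) : gProj K U k (algebraMap K _ r) =
      if 0 = k then algebraMap K _ r else 0 :=
    gProj_of_mem (SetLike.algebraMap_mem_graded _ r) k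
  have hι (m : Module.Dual K U) (k : ℕ) : gProj K U k (CliffordAlgebra.ι 0 m) =
      if 1 = k then CliffordAlgebra.ι 0 m else 0 :=
    gProj_of_mem (by
      rw [ExteriorAlgebra.exteriorPower, pow_one]; exact LinearMap.mem_range_self _ m) k
  have hιmul (m : Module.Dual K U) (k : ℕ) (y : Sp K U) :
      gProj K U (k + 1) (CliffordAlgebra.ι 0 m * y) = CliffordAlgebra.ι 0 m * gProj K U k y := by
    rw [gProj_mul, Finset.sum_eq_single (1, k)]
    · simp [hι]
    · rintro ⟨i, j⟩ hij hne
      rw [hι, if_neg, zero_mul]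
      rintro rfl
      rw [Finset.HasAntidiagonal.mem_antidiagonal] at hij
      exact hne (Prod.ext rfl (by simp at hij ⊢; omega))
    · simp [add_comm]
  induction x using CliffordAlgebra.left_induction generalizing n with
  | algebraMap r =>
    rw [CliffordAlgebra.contractLeft_algebraMap]
    have := hscal r (n + 1)
    simp at this
    simp [this]
  | add a b ha hb => simp only [map_add, ha, hb]
  | ι_mul a m ha =>
    rw [CliffordAlgebra.contractLeft_ι_mul, hιmul, CliffordAlgebra.contractLeft_ι_mul, map_sub,
      map_smul]
    congr 1
    cases n with
    | zero =>
      have h0 : gProj K U 0 a ∈ ⋀[K]^0 (Module.Dual K U) := gProj_mem 0 a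
      rw [ExteriorAlgebra.exteriorPower, pow_zero] at h0
      obtain ⟨r, hr⟩ := Submodule.mem_one.1 h0
      rw [← hr]
      erw [CliffordAlgebra.contractLeft_algebraMap]
      rw [gProj_mul]
      simp [hι]
    | succ k => rw [hιmul, ha]

theorem gProj_finrank_contractLeft [FiniteDimensional K U] (d : Module.Dual K (Module.Dual K U))
    (x : Sp K U) :
    gProj K U (Module.finrank K U)
      (CliffordAlgebra.contractLeft (Q := (0 : QuadraticForm K (Module.Dual K U))) d x) = 0 := by
  rw [gProj_contractLeft, gProj_eq_zero (Nat.lt_succ_self _), map_zero]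

/-- Moving a degree-`i` form past `y` applies the parity involution `i` times to `y`. -/
theorem mul_gProj (i : ℕ) (x y : Sp K U) :
    y * gProj K U i x = gProj K U i x *
      (CliffordAlgebra.involute (Q := (0 : QuadraticForm K (Module.Dual K U))))^[i] y := by
  have key : ∀ z ∈ ⋀[K]^i (Module.Dual K U), ∀ y : Sp K U, y * z = z *
      (CliffordAlgebra.involute (Q := (0 : QuadraticForm K (Module.Dual K U))))^[i] y := by
    intro z hz
    induction hz using Submodule.pow_induction_on_left' with
    | algebraMap r => intro y; simp [Algebra.commutes]
    | add a b k _ _ ha hb => intro y; rw [mul_add, add_mul, ha, hb]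
    | mem_mul m hm k a _ ha =>
      intro y
      obtain ⟨v, rfl⟩ := hm
      have h := ExteriorAlgebra.ι_mul_eq_involute_mul v
        (CliffordAlgebra.involute (Q := (0 : QuadraticForm K (Module.Dual K U))) y)
      rw [CliffordAlgebra.involute_involute] at h
      rw [← mul_assoc, ← h, mul_assoc, ha, Function.iterate_succ_apply, mul_assoc]
  exact key _ (gProj_mem i x) y

end Grading

section ComplexSpinors

variable {U U' : Type*} [AddCommGroup U] [Module ℝ U] [AddCommGroup U'] [Module ℝ U']

/-- the parity involution on `Λ U* ⊗ ℂ` -/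
def involuteSC (U : Type*) [AddCommGroup U] [Module ℝ U] : SpC U →ₐ[ℂ] SpC U :=
  Algebra.TensorProduct.map (AlgHom.id ℂ ℂ)
    (CliffordAlgebra.involute (Q := (0 : QuadraticForm ℝ (Module.Dual ℝ U))))

theorem projSC_tmul (n : ℕ) (z : ℂ) (x : Sp ℝ U) :
    projSC U n (z ⊗ₜ x) = z ⊗ₜ gProj ℝ U n x :=
  rfl

theorem revSC_tmul (z : ℂ) (x : Sp ℝ U) :
    revSC U (z ⊗ₜ x) =
      z ⊗ₜ CliffordAlgebra.reverse (Q := (0 : QuadraticForm ℝ (Module.Dual ℝ U))) x :=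
  rfl

theorem conjSC_tmul (z : ℂ) (x : Sp ℝ U) :
    conjSC U (z ⊗ₜ x) = (starRingEnd ℂ z) ⊗ₜ x :=
  rfl

theorem involuteSC_tmul (z : ℂ) (x : Sp ℝ U) :
    involuteSC U (z ⊗ₜ x) =
      z ⊗ₜ CliffordAlgebra.involute (Q := (0 : QuadraticForm ℝ (Module.Dual ℝ U))) x :=
  rfl

theorem pbC_tmul (f : U →ₗ[ℝ] U') (z : ℂ) (x : Sp ℝ U') :
    pbC U U' f (z ⊗ₜ x) =
      z ⊗ₜ ExteriorAlgebra.map (Module.Dual.transpose (R := ℝ) f) x :=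
  rfl

theorem projSC_mul (n : ℕ) (x y : SpC U) :
    projSC U n (x * y) =
      ∑ p ∈ Finset.HasAntidiagonal.antidiagonal n, projSC U p.1 x * projSC U p.2 y := by
  induction x using TensorProduct.induction_on with
  | zero => simp
  | add a b ha hb => simp only [map_add, add_mul, Finset.sum_add_distrib, ha, hb]
  | tmul z a =>
    induction y using TensorProduct.induction_on with
    | zero => simp
    | add a b ha hb => simp only [map_add, mul_add, Finset.sum_add_distrib, ha, hb]
    | tmul w b =>
      simp only [Algebra.TensorProduct.tmul_mul_tmul, projSC_tmul, gProj_mul,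
        TensorProduct.tmul_sum]

theorem projSC_pbC (f : U →ₗ[ℝ] U') (n : ℕ) (x : SpC U') :
    projSC U n (pbC U U' f x) = pbC U U' f (projSC U' n x) := by
  induction x using TensorProduct.induction_on with
  | zero => simp
  | add a b ha hb => simp only [map_add, ha, hb]
  | tmul z a => simp only [pbC_tmul, projSC_tmul, gProj_map]

theorem projSC_projSC (m n : ℕ) (x : SpC U) :
    projSC U m (projSC U n x) = if n = m then projSC U n x else 0 := by
  induction x using TensorProduct.induction_on with
  | zero => simp
  | add a b ha hb => simp only [map_add, ha, hb]; split_ifs <;> simp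
  | tmul z a =>
    simp only [projSC_tmul, gProj_of_mem (gProj_mem n a)]
    split_ifs <;> simp

theorem projSC_eq_zero [FiniteDimensional ℝ U] {n : ℕ} (hn : Module.finrank ℝ U < n)
    (x : SpC U) : projSC U n x = 0 := by
  induction x using TensorProduct.induction_on with
  | zero => simp
  | add a b ha hb => simp only [map_add, ha, hb, add_zero]
  | tmul z a => rw [projSC_tmul, gProj_eq_zero hn, TensorProduct.tmul_zero]

theorem sum_projSC [FiniteDimensional ℝ U] (x : SpC U) :
    ∑ n ∈ Finset.range (Module.finrank ℝ U + 1), projSC U n x = x := by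
  induction x using TensorProduct.induction_on with
  | zero => simp
  | add a b ha hb => simp only [map_add, Finset.sum_add_distrib, ha, hb]
  | tmul z a =>
    simp only [projSC_tmul, ← TensorProduct.tmul_sum]
    rw [sum_gProj]
    exact fun n hn x => gProj_eq_zero (by rw [Finset.mem_range] at hn; omega) x

theorem exists_projSC_ne_zero [FiniteDimensional ℝ U] {x : SpC U} (hx : x ≠ 0) :
    ∃ k, projSC U k x ≠ 0 := by
  by_contra! h
  exact hx (by rw [← sum_projSC x, Finset.sum_eq_zero fun k _ => h k])

theorem revSC_mul (x y : SpC U) : revSC U (x * y) = revSC U y * revSC U x := by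
  induction x using TensorProduct.induction_on with
  | zero => simp
  | add a b ha hb => simp only [map_add, add_mul, mul_add, ha, hb]
  | tmul z a =>
    induction y using TensorProduct.induction_on with
    | zero => simp
    | add a b ha hb => simp only [map_add, add_mul, mul_add, ha, hb]
    | tmul w b =>
      simp only [Algebra.TensorProduct.tmul_mul_tmul, revSC_tmul,
        CliffordAlgebra.reverse.map_mul, mul_comm z w]

theorem conjSC_mul (x y : SpC U) : conjSC U (x * y) = conjSC U x * conjSC U y := by
  induction x using TensorProduct.induction_on with
  | zero => simp
  | add a b ha hb => simp only [map_add, add_mul, ha, hb]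
  | tmul z a =>
    induction y using TensorProduct.induction_on with
    | zero => simp
    | add a b ha hb => simp only [map_add, mul_add, ha, hb]
    | tmul w b => simp only [Algebra.TensorProduct.tmul_mul_tmul, conjSC_tmul, map_mul]

theorem revSC_pbC (f : U →ₗ[ℝ] U') (x : SpC U') :
    revSC U (pbC U U' f x) = pbC U U' f (revSC U' x) := by
  induction x using TensorProduct.induction_on with
  | zero => simp
  | add a b ha hb => simp only [map_add, ha, hb]
  | tmul z a => simp only [pbC_tmul, revSC_tmul, ExteriorAlgebra.reverse_map]

theorem conjSC_pbC (f : U →ₗ[ℝ] U') (x : SpC U') :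
    conjSC U (pbC U U' f x) = pbC U U' f (conjSC U' x) := by
  induction x using TensorProduct.induction_on with
  | zero => simp
  | add a b ha hb => simp only [map_add, ha, hb]
  | tmul z a => simp only [pbC_tmul, conjSC_tmul]

theorem involuteSC_pbC (f : U →ₗ[ℝ] U') (x : SpC U') :
    involuteSC U (pbC U U' f x) = pbC U U' f (involuteSC U' x) := by
  induction x using TensorProduct.induction_on with
  | zero => simp
  | add a b ha hb => simp only [map_add, ha, hb]
  | tmul z a => simp only [pbC_tmul, involuteSC_tmul, ExteriorAlgebra.involute_map]

theorem involuteSC_involutive : Function.Involutive (involuteSC U) := by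
  intro x
  induction x using TensorProduct.induction_on with
  | zero => simp
  | add a b ha hb => simp only [map_add, ha, hb]
  | tmul z a => simp only [involuteSC_tmul, CliffordAlgebra.involute_involute]

theorem mul_projSC (i : ℕ) (x y : SpC U) :
    y * projSC U i x = projSC U i x * (involuteSC U)^[i] y := by
  induction x using TensorProduct.induction_on with
  | zero => simp
  | add a b ha hb => simp only [map_add, mul_add, add_mul, ha, hb]
  | tmul z a =>
    induction y using TensorProduct.induction_on with
    | zero => simp
    | add a b ha hb => simp only [iterate_map_add, mul_add, add_mul, ha, hb]
    | tmul w b =>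
      have h (j : ℕ) (w : ℂ) (b : Sp ℝ U) : (involuteSC U)^[j] (w ⊗ₜ b) =
          w ⊗ₜ (CliffordAlgebra.involute
            (Q := (0 : QuadraticForm ℝ (Module.Dual ℝ U))))^[j] b := by
        induction j generalizing b with
        | zero => rfl
        | succ j ih => rw [Function.iterate_succ_apply, involuteSC_tmul, ih,
            Function.iterate_succ_apply]
      rw [h, projSC_tmul, Algebra.TensorProduct.tmul_mul_tmul,
        Algebra.TensorProduct.tmul_mul_tmul, mul_gProj, mul_comm]

end ComplexSpinors

section Product

variable {V₁ V₂ : Type*} [AddCommGroup V₁] [Module ℝ V₁] [AddCommGroup V₂] [Module ℝ V₂]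

open CliffordAlgebra in
/-- The wedge of pullbacks from the two factors determines their tensor product. -/
theorem exists_map_fst_mul_map_snd_eq_tmul (V₁ V₂ : Type*) [AddCommGroup V₁] [Module ℝ V₁]
    [AddCommGroup V₂] [Module ℝ V₂] :
    ∃ F : Sp ℝ (V₁ × V₂) →ₗ[ℝ] Sp ℝ V₁ ⊗[ℝ] Sp ℝ V₂, ∀ x y,
      F (ExteriorAlgebra.map (Module.Dual.transpose (R := ℝ) (LinearMap.fst ℝ V₁ V₂)) x *
        ExteriorAlgebra.map (Module.Dual.transpose (R := ℝ) (LinearMap.snd ℝ V₁ V₂)) y) =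
      x ⊗ₜ y := by
  let Q₁ : QuadraticForm ℝ (Module.Dual ℝ V₁) := 0
  let Q₂ : QuadraticForm ℝ (Module.Dual ℝ V₂) := 0
  let e : (0 : QuadraticForm ℝ (Module.Dual ℝ (V₁ × V₂))) →qᵢ Q₁.prod Q₂ :=
    { toLinearMap := (Module.Dual.transpose (R := ℝ) (LinearMap.inl ℝ V₁ V₂)).prod
        (Module.Dual.transpose (R := ℝ) (LinearMap.inr ℝ V₁ V₂))
      map_app' := fun m => by simp [Q₁, Q₂] }
  let G := (ofProd Q₁ Q₂).comp (CliffordAlgebra.map e)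
  have hG₁ : G.comp (ExteriorAlgebra.map
      (Module.Dual.transpose (R := ℝ) (LinearMap.fst ℝ V₁ V₂))) =
      GradedTensorProduct.includeLeft (evenOdd Q₁) (evenOdd Q₂) := by
    apply ExteriorAlgebra.hom_ext
    ext m
    have h₁ := ExteriorAlgebra.map_apply_ι
      (Module.Dual.transpose (R := ℝ) (LinearMap.fst ℝ V₁ V₂)) m
    have h₂ := map_apply_ι e (Module.Dual.transpose (R := ℝ) (LinearMap.fst ℝ V₁ V₂) m)
    have h₃ : e (Module.Dual.transpose (R := ℝ) (LinearMap.fst ℝ V₁ V₂) m) = (m, 0) := by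
      refine Prod.ext (LinearMap.ext fun x => ?_) (LinearMap.ext fun x => ?_)
      · change m x = m x
        rfl
      · change m 0 = 0
        exact map_zero m
    simp only [LinearMap.comp_apply, AlgHom.toLinearMap_apply, AlgHom.comp_apply, G]
    erw [h₁, h₂, h₃, ofProd_ι_mk]
    have h₀ : GradedTensorProduct.tmul ℝ (𝒜 := evenOdd Q₁) (ℬ := evenOdd Q₂) 1
        (ι Q₂ 0) = 0 := by
      simp
    erw [h₀, add_zero]
    rfl
  have hG₂ : G.comp (ExteriorAlgebra.map
      (Module.Dual.transpose (R := ℝ) (LinearMap.snd ℝ V₁ V₂))) =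
      GradedTensorProduct.includeRight (evenOdd Q₁) (evenOdd Q₂) := by
    apply ExteriorAlgebra.hom_ext
    ext m
    have h₁ := ExteriorAlgebra.map_apply_ι
      (Module.Dual.transpose (R := ℝ) (LinearMap.snd ℝ V₁ V₂)) m
    have h₂ := map_apply_ι e (Module.Dual.transpose (R := ℝ) (LinearMap.snd ℝ V₁ V₂) m)
    have h₃ : e (Module.Dual.transpose (R := ℝ) (LinearMap.snd ℝ V₁ V₂) m) = (0, m) := by
      refine Prod.ext (LinearMap.ext fun x => ?_) (LinearMap.ext fun x => ?_)
      · change m 0 = 0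
        exact map_zero m
      · change m x = m x
        rfl
    simp only [LinearMap.comp_apply, AlgHom.toLinearMap_apply, AlgHom.comp_apply, G]
    erw [h₁, h₂, h₃, ofProd_ι_mk]
    have h₀ : GradedTensorProduct.tmul ℝ (𝒜 := evenOdd Q₁) (ℬ := evenOdd Q₂)
        (ι Q₁ 0) 1 = 0 := by
      simp
    erw [h₀, zero_add]
    rfl
  refine ⟨(GradedTensorProduct.of ℝ (evenOdd Q₁) (evenOdd Q₂)).symm.toLinearMap ∘ₗ G.toLinearMap,
    fun x y => ?_⟩
  have h₁ := DFunLike.congr_fun hG₁ x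
  have h₂ := DFunLike.congr_fun hG₂ y
  simp only [AlgHom.comp_apply] at h₁ h₂
  simp only [LinearMap.comp_apply, AlgHom.toLinearMap_apply, map_mul, h₁, h₂]
  rw [GradedTensorProduct.includeLeft_apply, GradedTensorProduct.includeRight_apply,
    GradedTensorProduct.tmul_one_mul_one_tmul]
  rfl

theorem pbC_fst_mul_pbC_snd_ne_zero {x : SpC V₁} {y : SpC V₂} (hx : x ≠ 0) (hy : y ≠ 0) :
    pbC (V₁ × V₂) V₁ (LinearMap.fst ℝ V₁ V₂) x * pbC (V₁ × V₂) V₂ (LinearMap.snd ℝ V₁ V₂) y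
      ≠ 0 := by
  obtain ⟨F, hF⟩ := exists_map_fst_mul_map_snd_eq_tmul V₁ V₂
  have key (x : SpC V₁) (y : SpC V₂) : F.baseChange ℂ
      (pbC (V₁ × V₂) V₁ (LinearMap.fst ℝ V₁ V₂) x * pbC (V₁ × V₂) V₂ (LinearMap.snd ℝ V₁ V₂) y) =
      (AlgebraTensorModule.distribBaseChange ℝ ℂ (Sp ℝ V₁) (Sp ℝ V₂)).symm (x ⊗ₜ y) := by
    induction x using TensorProduct.induction_on with
    | zero => simp
    | add a b ha hb => simp only [map_add, add_mul, TensorProduct.add_tmul, ha, hb]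
    | tmul z a =>
      induction y using TensorProduct.induction_on with
      | zero => simp
      | add a b ha hb => simp only [map_add, mul_add, TensorProduct.tmul_add, ha, hb]
      | tmul w b =>
        rw [pbC_tmul, pbC_tmul, Algebra.TensorProduct.tmul_mul_tmul, LinearMap.baseChange_tmul, hF,
          AlgebraTensorModule.distribBaseChange_symm_tmul]
  intro h
  have h₁ := key x y
  rw [h, map_zero, eq_comm, LinearEquiv.map_eq_zero_iff] at h₁
  obtain ⟨f, hf⟩ := Module.Projective.exists_dual_ne_zero ℂ hx
  obtain ⟨g, hg⟩ := Module.Projective.exists_dual_ne_zero ℂ hy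
  have h₂ := congrArg (LinearMap.mul' ℂ ℂ ∘ₗ TensorProduct.map f g) h₁
  simp only [LinearMap.comp_apply, TensorProduct.map_tmul, LinearMap.mul'_apply, map_zero] at h₂
  exact mul_ne_zero hf hg h₂

theorem typeOf_pbC_fst_mul_pbC_snd {x : SpC V₁} {y : SpC V₂}
    (hx : ∃ k, projSC V₁ k x ≠ 0) (hy : ∃ k, projSC V₂ k y ≠ 0) :
    typeOf (V₁ × V₂) (pbC (V₁ × V₂) V₁ (LinearMap.fst ℝ V₁ V₂) x *
      pbC (V₁ × V₂) V₂ (LinearMap.snd ℝ V₁ V₂) y) = typeOf V₁ x + typeOf V₂ y := by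
  have hx₁ : projSC V₁ (typeOf V₁ x) x ≠ 0 := Nat.sInf_mem hx
  have hy₁ : projSC V₂ (typeOf V₂ y) y ≠ 0 := Nat.sInf_mem hy
  have hx₀ {k : ℕ} (hk : k < typeOf V₁ x) : projSC V₁ k x = 0 := by
    simpa using Nat.notMem_of_lt_sInf hk
  have hy₀ {k : ℕ} (hk : k < typeOf V₂ y) : projSC V₂ k y = 0 := by
    simpa using Nat.notMem_of_lt_sInf hk
  have hmem : projSC (V₁ × V₂) (typeOf V₁ x + typeOf V₂ y)
      (pbC (V₁ × V₂) V₁ (LinearMap.fst ℝ V₁ V₂) x *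
        pbC (V₁ × V₂) V₂ (LinearMap.snd ℝ V₁ V₂) y) ≠ 0 := by
    rw [projSC_mul, Finset.sum_eq_single (typeOf V₁ x, typeOf V₂ y)]
    · rw [projSC_pbC, projSC_pbC]
      exact pbC_fst_mul_pbC_snd_ne_zero hx₁ hy₁
    · rintro ⟨i, j⟩ hij hne
      rw [Finset.HasAntidiagonal.mem_antidiagonal] at hij
      rw [projSC_pbC, projSC_pbC]
      rcases lt_or_ge i (typeOf V₁ x) with hi | hi
      · simp [hx₀ hi]
      · have hj : j < typeOf V₂ y := by
          by_contra! hj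
          exact hne (Prod.ext (by simp at hij ⊢; omega) (by simp at hij ⊢; omega))
        simp [hy₀ hj]
    · simp
  refine le_antisymm (Nat.sInf_le hmem) (le_csInf ⟨_, hmem⟩ fun k hk => ?_)
  by_contra! hlt
  refine hk ?_
  rw [projSC_mul]
  refine Finset.sum_eq_zero ?_
  rintro ⟨i, j⟩ hij
  rw [Finset.HasAntidiagonal.mem_antidiagonal] at hij
  rw [projSC_pbC, projSC_pbC]
  rcases lt_or_ge i (typeOf V₁ x) with hi | hi
  · simp [hx₀ hi]
  · have hj : j < typeOf V₂ y := by simp at hij; omega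
    simp [hy₀ hj]

variable [FiniteDimensional ℝ V₁] [FiniteDimensional ℝ V₂]

theorem projSC_finrank_pbC_mul_pbC (x : SpC V₁) (y : SpC V₂) :
    projSC (V₁ × V₂) (Module.finrank ℝ (V₁ × V₂)) (pbC (V₁ × V₂) V₁ (LinearMap.fst ℝ V₁ V₂) x *
      pbC (V₁ × V₂) V₂ (LinearMap.snd ℝ V₁ V₂) y) =
    pbC (V₁ × V₂) V₁ (LinearMap.fst ℝ V₁ V₂) (projSC V₁ (Module.finrank ℝ V₁) x) *
      pbC (V₁ × V₂) V₂ (LinearMap.snd ℝ V₁ V₂) (projSC V₂ (Module.finrank ℝ V₂) y) := by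
  rw [Module.finrank_prod, projSC_mul,
    Finset.sum_eq_single (Module.finrank ℝ V₁, Module.finrank ℝ V₂)]
  · rw [projSC_pbC, projSC_pbC]
  · rintro ⟨i, j⟩ hij hne
    rw [Finset.HasAntidiagonal.mem_antidiagonal] at hij
    rw [projSC_pbC, projSC_pbC]
    rcases lt_or_ge (Module.finrank ℝ V₁) i with hi | hi
    · simp [projSC_eq_zero hi]
    · have hj : Module.finrank ℝ V₂ < j := by
        by_contra! hj
        exact hne (Prod.ext (by simp at hij ⊢; omega) (by simp at hij ⊢; omega))
      simp [projSC_eq_zero hj]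
  · simp

theorem projSC_finrank_pbC_mul_pbC_mul_pbC (hV₁ : Even (Module.finrank ℝ V₁))
    (a : SpC V₂) (b : SpC V₁) (c : SpC V₂) :
    projSC (V₁ × V₂) (Module.finrank ℝ (V₁ × V₂))
      (pbC (V₁ × V₂) V₂ (LinearMap.snd ℝ V₁ V₂) a * pbC (V₁ × V₂) V₁ (LinearMap.fst ℝ V₁ V₂) b *
        pbC (V₁ × V₂) V₂ (LinearMap.snd ℝ V₁ V₂) c) =
    pbC (V₁ × V₂) V₁ (LinearMap.fst ℝ V₁ V₂) (projSC V₁ (Module.finrank ℝ V₁) b) *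
      pbC (V₁ × V₂) V₂ (LinearMap.snd ℝ V₁ V₂) (projSC V₂ (Module.finrank ℝ V₂) (a * c)) := by
  have hcomm (i : ℕ) : pbC (V₁ × V₂) V₂ (LinearMap.snd ℝ V₁ V₂) a *
      pbC (V₁ × V₂) V₁ (LinearMap.fst ℝ V₁ V₂) (projSC V₁ i b) =
      pbC (V₁ × V₂) V₁ (LinearMap.fst ℝ V₁ V₂) (projSC V₁ i b) *
        pbC (V₁ × V₂) V₂ (LinearMap.snd ℝ V₁ V₂) ((involuteSC V₂)^[i] a) := by
    rw [← projSC_pbC, mul_projSC]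
    congr 1
    exact (Function.Semiconj.iterate_right (f := pbC (V₁ × V₂) V₂ (LinearMap.snd ℝ V₁ V₂))
      (fun x => (involuteSC_pbC _ x).symm) i a).symm
  conv_lhs => rw [← sum_projSC b]
  simp only [map_sum, Finset.mul_sum, Finset.sum_mul, hcomm]
  simp only [mul_assoc, ← map_mul, projSC_finrank_pbC_mul_pbC, projSC_projSC]
  rw [Finset.sum_eq_single (Module.finrank ℝ V₁)]
  · rw [if_pos rfl, involuteSC_involutive.iterate_even hV₁, id_eq]
  · intro i _ hi
    simp [hi]
  · simp

theorem pairSC_pbC_mul_pbC (hV₁ : Even (Module.finrank ℝ V₁)) (x x' : SpC V₁) (y y' : SpC V₂) :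
    pairSC (V₁ × V₂) (Module.finrank ℝ (V₁ × V₂))
      (pbC (V₁ × V₂) V₁ (LinearMap.fst ℝ V₁ V₂) x * pbC (V₁ × V₂) V₂ (LinearMap.snd ℝ V₁ V₂) y)
      (pbC (V₁ × V₂) V₁ (LinearMap.fst ℝ V₁ V₂) x' *
        pbC (V₁ × V₂) V₂ (LinearMap.snd ℝ V₁ V₂) y') =
    pbC (V₁ × V₂) V₁ (LinearMap.fst ℝ V₁ V₂) (pairSC V₁ (Module.finrank ℝ V₁) x x') *
      pbC (V₁ × V₂) V₂ (LinearMap.snd ℝ V₁ V₂) (pairSC V₂ (Module.finrank ℝ V₂) y y') := by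
  rw [pairSC, pairSC, pairSC, ← projSC_finrank_pbC_mul_pbC_mul_pbC hV₁, revSC_mul, revSC_pbC,
    revSC_pbC,
    map_mul (pbC (V₁ × V₂) V₁ (LinearMap.fst ℝ V₁ V₂))]
  simp only [mul_assoc]

end Product

section CliffordAction

variable {U : Type*} [AddCommGroup U] [Module ℝ U]

/-- the canonical pairing on `U ⊕ U*`, normalised as the polar form of the Clifford relation -/
def canonicalForm (U : Type*) [AddCommGroup U] [Module ℝ U] :
    LinearMap.BilinForm ℝ (U × Module.Dual ℝ U) :=
  LinearMap.mk₂ ℝ (fun a b => a.2 b.1 + b.2 a.1)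
    (fun a a' b => by simp; ring) (fun c a b => by simp; ring)
    (fun a b b' => by simp; ring) (fun c a b => by simp; ring)

theorem canonicalForm_apply (a b : U × Module.Dual ℝ U) :
    canonicalForm U a b = a.2 b.1 + b.2 a.1 :=
  rfl

theorem gAct_apply (a : U × Module.Dual ℝ U) (x : Sp ℝ U) :
    gAct ℝ U a x =
      CliffordAlgebra.contractLeft (Q := (0 : QuadraticForm ℝ (Module.Dual ℝ U)))
        (Module.Dual.eval ℝ U a.1) x + ExteriorAlgebra.ι ℝ a.2 * x :=
  rfl

theorem gAct_gAct_add_swap (a b : U × Module.Dual ℝ U) (x : Sp ℝ U) :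
    gAct ℝ U a (gAct ℝ U b x) + gAct ℝ U b (gAct ℝ U a x) = canonicalForm U a b • x := by
  have h := congrArg (· * x) (ExteriorAlgebra.ι_add_mul_swap (R := ℝ) a.2 b.2)
  simp only [add_mul, zero_mul, mul_assoc] at h
  have hc := CliffordAlgebra.contractLeft_comm
    (Q := (0 : QuadraticForm ℝ (Module.Dual ℝ U)))
    (Module.Dual.eval ℝ U a.1) (Module.Dual.eval ℝ U b.1) x
  have h₁ := CliffordAlgebra.contractLeft_ι_mul
    (Q := (0 : QuadraticForm ℝ (Module.Dual ℝ U))) (Module.Dual.eval ℝ U a.1) b.2 x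
  have h₂ := CliffordAlgebra.contractLeft_ι_mul
    (Q := (0 : QuadraticForm ℝ (Module.Dual ℝ U))) (Module.Dual.eval ℝ U b.1) a.2 x
  simp only [gAct_apply, map_add, canonicalForm_apply, add_smul]
  erw [hc, h₁, h₂]
  rw [Module.Dual.eval_apply, Module.Dual.eval_apply]
  erw [eq_sub_of_add_eq h]
  simp only [ExteriorAlgebra.ι]
  abel

theorem gProj_reverse_gAct_mul [FiniteDimensional ℝ U] (a : U × Module.Dual ℝ U) (x y : Sp ℝ U) :
    gProj ℝ U (Module.finrank ℝ U) (CliffordAlgebra.reverse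
        (Q := (0 : QuadraticForm ℝ (Module.Dual ℝ U))) (gAct ℝ U a x) * y) =
      gProj ℝ U (Module.finrank ℝ U) (CliffordAlgebra.reverse
        (Q := (0 : QuadraticForm ℝ (Module.Dual ℝ U))) x * gAct ℝ U a y) := by
  have h := gProj_finrank_contractLeft (Module.Dual.eval ℝ U a.1)
    (CliffordAlgebra.involute (CliffordAlgebra.reverse
      (Q := (0 : QuadraticForm ℝ (Module.Dual ℝ U))) x) * y)
  erw [ExteriorAlgebra.contractLeft_mul] at h
  rw [CliffordAlgebra.involute_involute, map_add] at h
  have hι : CliffordAlgebra.reverse (Q := (0 : QuadraticForm ℝ (Module.Dual ℝ U)))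
      (ExteriorAlgebra.ι ℝ a.2) = ExteriorAlgebra.ι ℝ a.2 := CliffordAlgebra.reverse_ι _
  have hr := ExteriorAlgebra.reverse_contractLeft (Module.Dual.eval ℝ U a.1) x
  rw [gAct_apply, gAct_apply, map_add, CliffordAlgebra.reverse.map_mul, hι, hr, add_mul, mul_add,
    map_add, map_add, neg_mul, map_neg, mul_assoc, neg_eq_of_add_eq_zero_right h]

theorem actC_tmul_tmul (z w : ℂ) (a : U × Module.Dual ℝ U) (x : Sp ℝ U) :
    actC U (z ⊗ₜ a) (w ⊗ₜ x) = (z * w) ⊗ₜ gAct ℝ U a x := by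
  simp [actC, TensorProduct.smul_tmul']

theorem actC_actC_add_swap (u v : ℂ ⊗[ℝ] (U × Module.Dual ℝ U)) (φ : SpC U) :
    actC U u (actC U v φ) + actC U v (actC U u φ) =
      LinearMap.BilinForm.baseChange ℂ (canonicalForm U) u v • φ := by
  induction u using TensorProduct.induction_on with
  | zero => simp
  | add a b ha hb =>
    simp only [map_add, LinearMap.add_apply, add_smul, ← ha, ← hb]
    abel
  | tmul z a =>
    induction v using TensorProduct.induction_on with
    | zero => simp
    | add c d hc hd =>
      simp only [map_add, LinearMap.add_apply, add_smul, ← hc, ← hd]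
      abel
    | tmul w b =>
      induction φ using TensorProduct.induction_on with
      | zero => simp
      | add c d hc hd =>
        simp only [map_add, smul_add, ← hc, ← hd]
        abel
      | tmul t x =>
        rw [LinearMap.BilinForm.baseChange_tmul]
        simp only [actC_tmul_tmul]
        rw [mul_left_comm w z t, ← TensorProduct.tmul_add, gAct_gAct_add_swap,
          TensorProduct.tmul_smul, TensorProduct.smul_tmul', TensorProduct.smul_tmul', smul_assoc,
          smul_eq_mul, mul_assoc]

theorem pairSC_actC [FiniteDimensional ℝ U] (u : ℂ ⊗[ℝ] (U × Module.Dual ℝ U)) (φ ψ : SpC U) :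
    pairSC U (Module.finrank ℝ U) (actC U u φ) ψ =
      pairSC U (Module.finrank ℝ U) φ (actC U u ψ) := by
  simp only [pairSC]
  induction u using TensorProduct.induction_on with
  | zero => simp
  | add a b ha hb => simp only [map_add, LinearMap.add_apply, add_mul, mul_add, ha, hb]
  | tmul z a =>
    induction φ using TensorProduct.induction_on with
    | zero => simp
    | add c d hc hd => simp only [map_add, add_mul, hc, hd]
    | tmul w x =>
      induction ψ using TensorProduct.induction_on with
      | zero => simp
      | add c d hc hd => simp only [map_add, mul_add, hc, hd]
      | tmul t y =>
        simp only [actC_tmul_tmul, revSC_tmul, Algebra.TensorProduct.tmul_mul_tmul, projSC_tmul,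
          gProj_reverse_gAct_mul]
        rw [mul_left_comm, mul_assoc]

/-- complex conjugation on `(U ⊕ U*) ⊗ ℂ` -/
def conjGen (U : Type*) [AddCommGroup U] [Module ℝ U] :
    ℂ ⊗[ℝ] (U × Module.Dual ℝ U) →ₗ[ℝ] ℂ ⊗[ℝ] (U × Module.Dual ℝ U) :=
  TensorProduct.map Complex.conjAe.toLinearMap LinearMap.id

theorem conjGen_tmul (z : ℂ) (a : U × Module.Dual ℝ U) :
    conjGen U (z ⊗ₜ a) = starRingEnd ℂ z ⊗ₜ a :=
  rfl

theorem conjSC_actC (u : ℂ ⊗[ℝ] (U × Module.Dual ℝ U)) (φ : SpC U) :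
    conjSC U (actC U u φ) = actC U (conjGen U u) (conjSC U φ) := by
  induction u using TensorProduct.induction_on with
  | zero => simp
  | add a b ha hb => simp only [map_add, LinearMap.add_apply, ha, hb]
  | tmul z a =>
    induction φ using TensorProduct.induction_on with
    | zero => simp
    | add c d hc hd => simp only [map_add, hc, hd]
    | tmul w x => simp only [actC_tmul_tmul, conjSC_tmul, conjGen_tmul, map_mul]

theorem mem_annC {u : ℂ ⊗[ℝ] (U × Module.Dual ℝ U)} {φ : SpC U} :
    u ∈ annC U φ ↔ actC U u φ = 0 :=
  Iff.rfl

theorem canonicalForm_eq_zero_of_mem_annC {φ : SpC U} (hφ : φ ≠ 0)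
    {u v : ℂ ⊗[ℝ] (U × Module.Dual ℝ U)} (hu : u ∈ annC U φ) (hv : v ∈ annC U φ) :
    LinearMap.BilinForm.baseChange ℂ (canonicalForm U) u v = 0 := by
  have h := actC_actC_add_swap u v φ
  rw [mem_annC.1 hu, mem_annC.1 hv, map_zero, map_zero, add_zero, eq_comm, smul_eq_zero] at h
  exact h.resolve_right hφ

theorem conjGen_mem_annC {u : ℂ ⊗[ℝ] (U × Module.Dual ℝ U)} {φ : SpC U} (hu : u ∈ annC U φ) :
    conjGen U u ∈ annC U (conjSC U φ) := by
  rw [mem_annC, ← conjSC_actC, mem_annC.1 hu, map_zero]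

end CliffordAction

section ComplexPart

variable {E : Type*} [AddCommGroup E] [Module ℝ E]

theorem exists_one_tmul_add_I_tmul (u : ℂ ⊗[ℝ] E) :
    ∃ a b : E, u = (1 : ℂ) ⊗ₜ[ℝ] a + Complex.I ⊗ₜ[ℝ] b := by
  induction u using TensorProduct.induction_on with
  | zero => exact ⟨0, 0, by simp⟩
  | tmul z a =>
    refine ⟨z.re • a, z.im • a, ?_⟩
    rw [← TensorProduct.smul_tmul, ← TensorProduct.smul_tmul, ← TensorProduct.add_tmul]
    congr 1
    apply Complex.ext <;> simp
  | add u v hu hv =>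
    obtain ⟨a, b, rfl⟩ := hu
    obtain ⟨c, d, rfl⟩ := hv
    refine ⟨a + c, b + d, ?_⟩
    simp only [TensorProduct.tmul_add]
    abel

/-- the real part of a vector of `ℂ ⊗ E` -/
def rePart (E : Type*) [AddCommGroup E] [Module ℝ E] : ℂ ⊗[ℝ] E →ₗ[ℝ] E :=
  (TensorProduct.lid ℝ E).toLinearMap ∘ₗ LinearMap.rTensor E Complex.reLm

theorem rePart_one_tmul_add_I_tmul (a b : E) :
    rePart E ((1 : ℂ) ⊗ₜ[ℝ] a + Complex.I ⊗ₜ[ℝ] b) = a := by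
  simp [rePart]

end ComplexPart

section Isotropic

variable {U : Type*} [AddCommGroup U] [Module ℝ U]

theorem canonicalForm_comm (a b : U × Module.Dual ℝ U) :
    canonicalForm U a b = canonicalForm U b a := by
  simp only [canonicalForm_apply, add_comm]

theorem canonicalForm_separatingLeft {a : U × Module.Dual ℝ U}
    (h : ∀ b, canonicalForm U a b = 0) : a = 0 := by
  refine Prod.ext ?_ (LinearMap.ext fun x => ?_)
  · refine (Module.forall_dual_apply_eq_zero_iff ℝ a.1).1 fun f => ?_
    simpa [canonicalForm_apply] using h (0, f)
  · simpa [canonicalForm_apply] using h (x, 0)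

theorem baseChange_canonicalForm_comm (u v : ℂ ⊗[ℝ] (U × Module.Dual ℝ U)) :
    LinearMap.BilinForm.baseChange ℂ (canonicalForm U) u v =
      LinearMap.BilinForm.baseChange ℂ (canonicalForm U) v u := by
  induction u using TensorProduct.induction_on with
  | zero => simp
  | add a b ha hb => simp only [map_add, LinearMap.add_apply, ha, hb]
  | tmul z a =>
    induction v using TensorProduct.induction_on with
    | zero => simp
    | add a b ha hb => simp only [map_add, LinearMap.add_apply, ha, hb]
    | tmul w b =>
      rw [LinearMap.BilinForm.baseChange_tmul, LinearMap.BilinForm.baseChange_tmul,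
        canonicalForm_comm, mul_comm]

theorem baseChange_canonicalForm_one_tmul_add_I_tmul (a b c d : U × Module.Dual ℝ U) :
    LinearMap.BilinForm.baseChange ℂ (canonicalForm U)
        ((1 : ℂ) ⊗ₜ[ℝ] a + Complex.I ⊗ₜ[ℝ] b) ((1 : ℂ) ⊗ₜ[ℝ] c + Complex.I ⊗ₜ[ℝ] d) =
      ⟨canonicalForm U a c - canonicalForm U b d, canonicalForm U a d + canonicalForm U b c⟩ := by
  simp only [map_add, LinearMap.add_apply, LinearMap.BilinForm.baseChange_tmul]
  apply Complex.ext <;> simp <;> ring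

theorem baseChange_canonicalForm_nondegenerate (U : Type*) [AddCommGroup U] [Module ℝ U] :
    (LinearMap.BilinForm.baseChange ℂ (canonicalForm U)).Nondegenerate := by
  have h (u : ℂ ⊗[ℝ] (U × Module.Dual ℝ U))
      (hu : ∀ v, LinearMap.BilinForm.baseChange ℂ (canonicalForm U) u v = 0) : u = 0 := by
    obtain ⟨a, b, rfl⟩ := exists_one_tmul_add_I_tmul u
    have h₁ (c : U × Module.Dual ℝ U) := hu ((1 : ℂ) ⊗ₜ[ℝ] c + Complex.I ⊗ₜ[ℝ] 0)
    simp only [baseChange_canonicalForm_one_tmul_add_I_tmul, map_zero, sub_zero, zero_add,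
      Complex.ext_iff, Complex.zero_re, Complex.zero_im] at h₁
    rw [canonicalForm_separatingLeft fun c => (h₁ c).1,
      canonicalForm_separatingLeft fun c => (h₁ c).2]
    simp
  exact ⟨h, fun v hv => h v fun u => by rw [baseChange_canonicalForm_comm, hv]⟩

theorem finrank_complexification [FiniteDimensional ℝ U] :
    Module.finrank ℂ (ℂ ⊗[ℝ] (U × Module.Dual ℝ U)) = 2 * Module.finrank ℝ U := by
  rw [Module.finrank_baseChange, Module.finrank_prod, Subspace.dual_finrank_eq, two_mul]

theorem finrank_annC_le [FiniteDimensional ℝ U] {φ : SpC U} (hφ : φ ≠ 0) :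
    Module.finrank ℂ (annC U φ) ≤ Module.finrank ℝ U := by
  have h₁ := LinearMap.BilinForm.finrank_orthogonal (baseChange_canonicalForm_nondegenerate U)
    (annC U φ)
  have h₂ : annC U φ ≤
      (LinearMap.BilinForm.baseChange ℂ (canonicalForm U)).orthogonal (annC U φ) :=
    fun u hu v hv => canonicalForm_eq_zero_of_mem_annC hφ hv hu
  have h₃ := Submodule.finrank_mono h₂
  have h₄ := Submodule.finrank_le (annC U φ)
  rw [finrank_complexification] at h₁ h₄
  omega

theorem eq_zero_of_mem_annC_of_pairSC_ne_zero [FiniteDimensional ℝ U] {φ ψ : SpC U}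
    (h : pairSC U (Module.finrank ℝ U) φ ψ ≠ 0) {u : ℂ ⊗[ℝ] (U × Module.Dual ℝ U)}
    (hu : u ∈ annC U φ) (hu' : u ∈ annC U ψ) : u = 0 := by
  refine (baseChange_canonicalForm_nondegenerate U).1 u fun v => ?_
  have h₁ := actC_actC_add_swap u v ψ
  rw [mem_annC.1 hu', map_zero, add_zero] at h₁
  have h₂ := pairSC_actC u φ (actC U v ψ)
  rw [mem_annC.1 hu, h₁] at h₂
  simp only [pairSC, map_zero, zero_mul, mul_smul_comm, map_smul] at h₂ h
  exact (smul_eq_zero.1 h₂.symm).resolve_right h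

theorem conjGen_I_tmul (b : U × Module.Dual ℝ U) :
    conjGen U (Complex.I ⊗ₜ b) = -(Complex.I ⊗ₜ b) := by
  rw [conjGen_tmul, Complex.conj_I, TensorProduct.neg_tmul]

theorem IsGCY.exists_I_tmul [FiniteDimensional ℝ U] {φ : SpC U} (h : IsGCY U φ)
    (a : U × Module.Dual ℝ U) :
    ∃ b, (1 : ℂ) ⊗ₜ[ℝ] a + Complex.I ⊗ₜ[ℝ] b ∈ annC U φ := by
  let L := (annC U φ).restrictScalars ℝ
  let f := rePart (U × Module.Dual ℝ U) ∘ₗ L.subtype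
  have hinj : Function.Injective f := by
    rw [← LinearMap.ker_eq_bot, LinearMap.ker_eq_bot']
    rintro ⟨u, hu⟩ hfu
    obtain ⟨a, b, rfl⟩ := exists_one_tmul_add_I_tmul u
    change rePart (U × Module.Dual ℝ U) ((1 : ℂ) ⊗ₜ[ℝ] a + Complex.I ⊗ₜ[ℝ] b) = 0 at hfu
    rw [rePart_one_tmul_add_I_tmul] at hfu
    subst hfu
    have hu' : (1 : ℂ) ⊗ₜ[ℝ] (0 : U × Module.Dual ℝ U) + Complex.I ⊗ₜ[ℝ] b ∈ annC U φ := hu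
    refine Subtype.ext (eq_zero_of_mem_annC_of_pairSC_ne_zero h.2 hu' ?_)
    have hc := conjGen_mem_annC hu'
    change (1 : ℂ) ⊗ₜ[ℝ] (0 : U × Module.Dual ℝ U) + Complex.I ⊗ₜ[ℝ] b ∈ annC U (conjSC U φ)
    rw [TensorProduct.tmul_zero, zero_add] at hc ⊢
    rw [conjGen_I_tmul] at hc
    exact (Submodule.neg_mem_iff _).1 hc
  have hrank : Module.finrank ℝ L = Module.finrank ℝ (U × Module.Dual ℝ U) := by
    have h₁ : Module.finrank ℝ L = 2 * Module.finrank ℂ (annC U φ) := by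
      rw [← Complex.finrank_real_complex]
      exact (Module.finrank_mul_finrank ℝ ℂ (annC U φ)).symm
    rw [h₁, h.1, Module.finrank_prod, Subspace.dual_finrank_eq, two_mul]
  have : FiniteDimensional ℝ L := inferInstance
  obtain ⟨⟨u, hu⟩, hfu⟩ := (LinearMap.injective_iff_surjective_of_finrank_eq_finrank hrank).1 hinj a
  obtain ⟨a', b, rfl⟩ := exists_one_tmul_add_I_tmul u
  change rePart (U × Module.Dual ℝ U) ((1 : ℂ) ⊗ₜ[ℝ] a' + Complex.I ⊗ₜ[ℝ] b) = a at hfu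
  rw [rePart_one_tmul_add_I_tmul] at hfu
  subst hfu
  exact ⟨b, hu⟩

end Isotropic

section EvenDimension

variable {U : Type*} [AddCommGroup U] [Module ℝ U] [FiniteDimensional ℝ U]

theorem IsGCY.ne_zero {φ : SpC U} (h : IsGCY U φ) : φ ≠ 0 := by
  rintro rfl
  exact h.2 (by simp [pairSC])

/-- A generalized Calabi–Yau structure exists only in even dimension. -/
theorem IsGCY.even_finrank {φ : SpC U} (h : IsGCY U φ) : Even (Module.finrank ℝ U) := by
  let e := Module.finBasis ℝ U
  let p (i : Fin (Module.finrank ℝ U)) : U × Module.Dual ℝ U := (e i, e.coord i)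
  choose b hb using fun i => h.exists_I_tmul (p i)
  have horth {a b c d : U × Module.Dual ℝ U}
      (h₁ : (1 : ℂ) ⊗ₜ[ℝ] a + Complex.I ⊗ₜ[ℝ] b ∈ annC U φ)
      (h₂ : (1 : ℂ) ⊗ₜ[ℝ] c + Complex.I ⊗ₜ[ℝ] d ∈ annC U φ) :
      canonicalForm U a c = canonicalForm U b d ∧
        canonicalForm U b c = -canonicalForm U a d := by
    have h₃ := canonicalForm_eq_zero_of_mem_annC h.ne_zero h₁ h₂
    rw [baseChange_canonicalForm_one_tmul_add_I_tmul] at h₃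
    exact ⟨sub_eq_zero.1 (congrArg Complex.re h₃),
      eq_neg_of_add_eq_zero_right (congrArg Complex.im h₃)⟩
  let K : Matrix (Fin (Module.finrank ℝ U)) (Fin (Module.finrank ℝ U)) ℝ :=
    Matrix.of fun i j => canonicalForm U (b i) (p j)
  have hskew : K.transpose = -K := by
    ext i j
    simp only [K, Matrix.transpose_apply, Matrix.neg_apply, Matrix.of_apply]
    rw [(horth (hb j) (hb i)).2, canonicalForm_comm]
  have hdet : K.det ≠ 0 := by
    rw [Ne, ← Matrix.exists_vecMul_eq_zero_iff]
    rintro ⟨x, hx, hxK⟩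
    have hmem : (1 : ℂ) ⊗ₜ[ℝ] (∑ i, x i • p i) + Complex.I ⊗ₜ[ℝ] (∑ i, x i • b i) ∈ annC U φ := by
      rw [TensorProduct.tmul_sum, TensorProduct.tmul_sum, ← Finset.sum_add_distrib]
      refine Submodule.sum_mem _ fun i _ => ?_
      rw [TensorProduct.tmul_smul, TensorProduct.tmul_smul, ← smul_add]
      exact Submodule.smul_of_tower_mem _ _ (hb i)
    have hnorm := (horth hmem hmem).1
    have hpp (i j) : canonicalForm U (p i) (p j) = if i = j then 2 else 0 := by
      simp only [canonicalForm_apply, p, Basis.coord_apply, Basis.repr_self,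
        Finsupp.single_apply, eq_comm (a := j)]
      split_ifs <;> norm_num
    have hpos : canonicalForm U (∑ i, x i • p i) (∑ i, x i • p i) = 2 * ∑ i, x i ^ 2 := by
      simp only [map_sum, map_smul, LinearMap.sum_apply, LinearMap.smul_apply, hpp, smul_eq_mul,
        mul_ite, mul_zero, Finset.sum_ite_eq', Finset.mem_univ, if_true, Finset.mul_sum]
      exact Finset.sum_congr rfl fun i _ => by ring
    set q := ∑ i, x i • b i with hq
    have hqp (j) : q.2 (e j) = -e.coord j q.1 := by
      have hj := congrFun hxK j
      have hj' : canonicalForm U q (p j) = 0 := by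
        rw [← hj.trans (Pi.zero_apply j), hq]
        simp [Matrix.vecMul, dotProduct, K]
      exact eq_neg_of_add_eq_zero_left hj'
    have hneg : canonicalForm U q q = -(2 * ∑ i, (e.coord i q.1) ^ 2) := by
      have h₁ : q.2 q.1 = -∑ i, (e.coord i q.1) ^ 2 := by
        conv_lhs => rw [← e.sum_repr q.1]
        simp only [map_sum, map_smul, smul_eq_mul, hqp, Basis.coord_apply, ← Finset.sum_neg_distrib]
        exact Finset.sum_congr rfl fun i _ => by ring
      rw [canonicalForm_apply, h₁]
      ring
    have hsum : ∑ i, x i ^ 2 = 0 := by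
      have h₁ : 0 ≤ ∑ i, x i ^ 2 := Finset.sum_nonneg fun i _ => sq_nonneg _
      have h₂ : 0 ≤ ∑ i, (e.coord i q.1) ^ 2 := Finset.sum_nonneg fun i _ => sq_nonneg _
      linarith
    refine hx (funext fun i => ?_)
    have h₁ := (Finset.sum_eq_zero_iff_of_nonneg fun i _ => sq_nonneg (x i)).1 hsum i
      (Finset.mem_univ i)
    simpa using h₁
  by_contra hodd
  rw [Nat.not_even_iff_odd] at hodd
  have h₁ := congrArg Matrix.det hskew
  rw [Matrix.det_transpose, Matrix.det_neg, Fintype.card_fin, hodd.neg_one_pow] at h₁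
  exact hdet (by linarith)

end EvenDimension

section ProductAnnihilator

variable {V₁ V₂ : Type*} [AddCommGroup V₁] [Module ℝ V₁] [AddCommGroup V₂] [Module ℝ V₂]

/-- the inclusion of `U ⊕ U*` into `U' ⊕ U'*` induced by `i : U → U'` with retraction `p` -/
def genIncl {U U' : Type*} [AddCommGroup U] [Module ℝ U] [AddCommGroup U'] [Module ℝ U']
    (i : U →ₗ[ℝ] U') (p : U' →ₗ[ℝ] U) :
    ℂ ⊗[ℝ] (U × Module.Dual ℝ U) →ₗ[ℂ] ℂ ⊗[ℝ] (U' × Module.Dual ℝ U') :=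
  LinearMap.baseChange ℂ (i.prodMap (Module.Dual.transpose (R := ℝ) p))

theorem genIncl_genIncl {U U' U'' : Type*} [AddCommGroup U] [Module ℝ U]
    [AddCommGroup U'] [Module ℝ U'] [AddCommGroup U''] [Module ℝ U'']
    (i : U →ₗ[ℝ] U') (p : U' →ₗ[ℝ] U) (j : U' →ₗ[ℝ] U'') (q : U'' →ₗ[ℝ] U')
    (u : ℂ ⊗[ℝ] (U × Module.Dual ℝ U)) :
    genIncl j q (genIncl i p u) = genIncl (j ∘ₗ i) (p ∘ₗ q) u := by
  rw [genIncl, genIncl, genIncl, ← LinearMap.comp_apply, ← LinearMap.baseChange_comp]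
  rfl

theorem genIncl_genIncl_of_comp_eq_id {U U' : Type*} [AddCommGroup U] [Module ℝ U]
    [AddCommGroup U'] [Module ℝ U'] (i : U →ₗ[ℝ] U') (p : U' →ₗ[ℝ] U)
    (h : p ∘ₗ i = LinearMap.id) (u : ℂ ⊗[ℝ] (U × Module.Dual ℝ U)) :
    genIncl p i (genIncl i p u) = u := by
  rw [genIncl_genIncl, h]
  exact DFunLike.congr_fun
    (LinearMap.baseChange_id (R := ℝ) (A := ℂ) (M := U × Module.Dual ℝ U)) u

theorem genIncl_genIncl_of_comp_eq_zero {U U' U'' : Type*} [AddCommGroup U] [Module ℝ U]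
    [AddCommGroup U'] [Module ℝ U'] [AddCommGroup U''] [Module ℝ U'']
    (i : U →ₗ[ℝ] U') (p : U' →ₗ[ℝ] U) (j : U' →ₗ[ℝ] U'') (q : U'' →ₗ[ℝ] U')
    (h : j ∘ₗ i = 0) (h' : p ∘ₗ q = 0) (u : ℂ ⊗[ℝ] (U × Module.Dual ℝ U)) :
    genIncl j q (genIncl i p u) = 0 := by
  have h₀ : (0 : U →ₗ[ℝ] U'').prodMap (Module.Dual.transpose (R := ℝ) (0 : U'' →ₗ[ℝ] U)) = 0 := by
    refine LinearMap.ext fun a => Prod.ext rfl ?_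
    simp
  rw [genIncl_genIncl, h, h', genIncl, h₀, LinearMap.baseChange_zero, LinearMap.zero_apply]

theorem gAct_fst (a : V₁ × Module.Dual ℝ V₁) (x : Sp ℝ V₁) (y : Sp ℝ V₂) :
    gAct ℝ (V₁ × V₂) ((LinearMap.inl ℝ V₁ V₂).prodMap
        (Module.Dual.transpose (R := ℝ) (LinearMap.fst ℝ V₁ V₂)) a)
      (ExteriorAlgebra.map (Module.Dual.transpose (R := ℝ) (LinearMap.fst ℝ V₁ V₂)) x *
        ExteriorAlgebra.map (Module.Dual.transpose (R := ℝ) (LinearMap.snd ℝ V₁ V₂)) y) =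
      ExteriorAlgebra.map (Module.Dual.transpose (R := ℝ) (LinearMap.fst ℝ V₁ V₂))
          (gAct ℝ V₁ a x) *
        ExteriorAlgebra.map (Module.Dual.transpose (R := ℝ) (LinearMap.snd ℝ V₁ V₂)) y := by
  have h₁ : Module.Dual.eval ℝ (V₁ × V₂) (a.1, 0) ∘ₗ
      Module.Dual.transpose (R := ℝ) (LinearMap.fst ℝ V₁ V₂) = Module.Dual.eval ℝ V₁ a.1 := rfl
  have h₂ : Module.Dual.eval ℝ (V₁ × V₂) (a.1, 0) ∘ₗ
      Module.Dual.transpose (R := ℝ) (LinearMap.snd ℝ V₁ V₂) = 0 :=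
    LinearMap.ext fun f => map_zero f
  rw [gAct_apply, gAct_apply, ExteriorAlgebra.contractLeft_mul]
  simp only [LinearMap.prodMap_apply, LinearMap.inl_apply]
  rw [ExteriorAlgebra.contractLeft_map, ExteriorAlgebra.contractLeft_map, h₁, h₂, map_zero,
    LinearMap.zero_apply, map_zero, mul_zero, add_zero, map_add, map_mul,
    ExteriorAlgebra.map_apply_ι, add_mul, mul_assoc]

theorem gAct_snd (a : V₂ × Module.Dual ℝ V₂) (x : Sp ℝ V₁) (y : Sp ℝ V₂) :
    gAct ℝ (V₁ × V₂) ((LinearMap.inr ℝ V₁ V₂).prodMap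
        (Module.Dual.transpose (R := ℝ) (LinearMap.snd ℝ V₁ V₂)) a)
      (ExteriorAlgebra.map (Module.Dual.transpose (R := ℝ) (LinearMap.fst ℝ V₁ V₂)) x *
        ExteriorAlgebra.map (Module.Dual.transpose (R := ℝ) (LinearMap.snd ℝ V₁ V₂)) y) =
      ExteriorAlgebra.map (Module.Dual.transpose (R := ℝ) (LinearMap.fst ℝ V₁ V₂))
          (CliffordAlgebra.involute (Q := (0 : QuadraticForm ℝ (Module.Dual ℝ V₁))) x) *
        ExteriorAlgebra.map (Module.Dual.transpose (R := ℝ) (LinearMap.snd ℝ V₁ V₂))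
          (gAct ℝ V₂ a y) := by
  have h₁ : Module.Dual.eval ℝ (V₁ × V₂) (0, a.1) ∘ₗ
      Module.Dual.transpose (R := ℝ) (LinearMap.snd ℝ V₁ V₂) = Module.Dual.eval ℝ V₂ a.1 := rfl
  have h₂ : Module.Dual.eval ℝ (V₁ × V₂) (0, a.1) ∘ₗ
      Module.Dual.transpose (R := ℝ) (LinearMap.fst ℝ V₁ V₂) = 0 :=
    LinearMap.ext fun f => map_zero f
  rw [gAct_apply, gAct_apply, ExteriorAlgebra.contractLeft_mul]
  simp only [LinearMap.prodMap_apply, LinearMap.inr_apply]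
  rw [ExteriorAlgebra.contractLeft_map, ExteriorAlgebra.contractLeft_map, h₁, h₂, map_zero,
    LinearMap.zero_apply, map_zero, zero_mul, zero_add, map_add, map_mul,
    ExteriorAlgebra.map_apply_ι, mul_add, ← mul_assoc, ExteriorAlgebra.ι_mul_eq_involute_mul,
    ExteriorAlgebra.involute_map, mul_assoc]

theorem actC_genIncl_fst (u : ℂ ⊗[ℝ] (V₁ × Module.Dual ℝ V₁)) (x : SpC V₁) (y : SpC V₂) :
    actC (V₁ × V₂) (genIncl (LinearMap.inl ℝ V₁ V₂) (LinearMap.fst ℝ V₁ V₂) u)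
      (pbC (V₁ × V₂) V₁ (LinearMap.fst ℝ V₁ V₂) x * pbC (V₁ × V₂) V₂ (LinearMap.snd ℝ V₁ V₂) y) =
      pbC (V₁ × V₂) V₁ (LinearMap.fst ℝ V₁ V₂) (actC V₁ u x) *
        pbC (V₁ × V₂) V₂ (LinearMap.snd ℝ V₁ V₂) y := by
  induction u using TensorProduct.induction_on with
  | zero => simp
  | add a b ha hb => simp only [map_add, LinearMap.add_apply, add_mul, ha, hb]
  | tmul z a =>
    induction x using TensorProduct.induction_on with
    | zero => simp
    | add c d hc hd => simp only [map_add, add_mul, hc, hd]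
    | tmul w x =>
      induction y using TensorProduct.induction_on with
      | zero => simp
      | add c d hc hd => simp only [map_add, mul_add, hc, hd]
      | tmul t y =>
        simp only [genIncl, LinearMap.baseChange_tmul, pbC_tmul, actC_tmul_tmul,
          Algebra.TensorProduct.tmul_mul_tmul, gAct_fst, mul_assoc]

theorem actC_genIncl_snd (u : ℂ ⊗[ℝ] (V₂ × Module.Dual ℝ V₂)) (x : SpC V₁) (y : SpC V₂) :
    actC (V₁ × V₂) (genIncl (LinearMap.inr ℝ V₁ V₂) (LinearMap.snd ℝ V₁ V₂) u)
      (pbC (V₁ × V₂) V₁ (LinearMap.fst ℝ V₁ V₂) x * pbC (V₁ × V₂) V₂ (LinearMap.snd ℝ V₁ V₂) y) =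
      pbC (V₁ × V₂) V₁ (LinearMap.fst ℝ V₁ V₂) (involuteSC V₁ x) *
        pbC (V₁ × V₂) V₂ (LinearMap.snd ℝ V₁ V₂) (actC V₂ u y) := by
  induction u using TensorProduct.induction_on with
  | zero => simp
  | add a b ha hb => simp only [map_add, LinearMap.add_apply, mul_add, ha, hb]
  | tmul z a =>
    induction x using TensorProduct.induction_on with
    | zero => simp
    | add c d hc hd => simp only [map_add, add_mul, hc, hd]
    | tmul w x =>
      induction y using TensorProduct.induction_on with
      | zero => simp
      | add c d hc hd => simp only [map_add, mul_add, hc, hd]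
      | tmul t y =>
        simp only [genIncl, LinearMap.baseChange_tmul, pbC_tmul, involuteSC_tmul, actC_tmul_tmul,
          Algebra.TensorProduct.tmul_mul_tmul, gAct_snd, mul_left_comm z w t]

theorem finrank_annC_add_le [FiniteDimensional ℝ V₁] [FiniteDimensional ℝ V₂]
    (x : SpC V₁) (y : SpC V₂) :
    Module.finrank ℂ (annC V₁ x) + Module.finrank ℂ (annC V₂ y) ≤
      Module.finrank ℂ (annC (V₁ × V₂) (pbC (V₁ × V₂) V₁ (LinearMap.fst ℝ V₁ V₂) x *
        pbC (V₁ × V₂) V₂ (LinearMap.snd ℝ V₁ V₂) y)) := by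
  let j₁ := genIncl (LinearMap.inl ℝ V₁ V₂) (LinearMap.fst ℝ V₁ V₂)
  let j₂ := genIncl (LinearMap.inr ℝ V₁ V₂) (LinearMap.snd ℝ V₁ V₂)
  let r₁ := genIncl (LinearMap.fst ℝ V₁ V₂) (LinearMap.inl ℝ V₁ V₂)
  let r₂ := genIncl (LinearMap.snd ℝ V₁ V₂) (LinearMap.inr ℝ V₁ V₂)
  have h₁₁ (u) : r₁ (j₁ u) = u := genIncl_genIncl_of_comp_eq_id _ _ (LinearMap.fst_comp_inl _ _ _) u
  have h₂₂ (u) : r₂ (j₂ u) = u := genIncl_genIncl_of_comp_eq_id _ _ (LinearMap.snd_comp_inr _ _ _) u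
  have h₁₂ (u) : r₁ (j₂ u) = 0 :=
    genIncl_genIncl_of_comp_eq_zero _ _ _ _ (LinearMap.fst_comp_inr _ _ _)
      (LinearMap.snd_comp_inl _ _ _) u
  have h₂₁ (u) : r₂ (j₁ u) = 0 :=
    genIncl_genIncl_of_comp_eq_zero _ _ _ _ (LinearMap.snd_comp_inl _ _ _)
      (LinearMap.fst_comp_inr _ _ _) u
  let f : annC V₁ x × annC V₂ y →ₗ[ℂ] _ :=
    (j₁ ∘ₗ (annC V₁ x).subtype).coprod (j₂ ∘ₗ (annC V₂ y).subtype)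
  have hf (u) : f u ∈ annC (V₁ × V₂) (pbC (V₁ × V₂) V₁ (LinearMap.fst ℝ V₁ V₂) x *
        pbC (V₁ × V₂) V₂ (LinearMap.snd ℝ V₁ V₂) y) := by
    refine Submodule.add_mem _ ?_ ?_
    · have h := actC_genIncl_fst (u.1 : ℂ ⊗[ℝ] (V₁ × Module.Dual ℝ V₁)) x y
      rw [mem_annC.1 u.1.2, map_zero, zero_mul] at h
      exact h
    · have h := actC_genIncl_snd (u.2 : ℂ ⊗[ℝ] (V₂ × Module.Dual ℝ V₂)) x y
      rw [mem_annC.1 u.2.2, map_zero, mul_zero] at h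
      exact h
  rw [← Module.finrank_prod]
  refine LinearMap.finrank_le_finrank_of_injective (f := f.codRestrict _ hf) ?_
  rw [← LinearMap.ker_eq_bot, LinearMap.ker_eq_bot']
  rintro ⟨u, v⟩ huv
  have h : j₁ u + j₂ v = 0 := congrArg Subtype.val huv
  have hu := congrArg r₁ h
  have hv := congrArg r₂ h
  rw [map_add, h₁₁, h₁₂, add_zero, map_zero] at hu
  rw [map_add, h₂₁, h₂₂, zero_add, map_zero] at hv
  exact Prod.ext (Subtype.ext hu) (Subtype.ext hv)

end ProductAnnihilator

/-- if `φ₁`, `φ₂` are generalized Calabi–Yau structures on `V₁`, `V₂`, then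
`p₁*φ₁ ∧ p₂*φ₂` is a generalized Calabi–Yau structure on `V₁ ⊕ V₂`, and its type is
`type(φ₁) + type(φ₂)`. -/
theorem product_of_GCY_is_GCY
    (V₁ V₂ : Type*) [AddCommGroup V₁] [Module ℝ V₁] [FiniteDimensional ℝ V₁]
    [AddCommGroup V₂] [Module ℝ V₂] [FiniteDimensional ℝ V₂]
    (φ₁ : SpC V₁) (φ₂ : SpC V₂) (h₁ : IsGCY V₁ φ₁) (h₂ : IsGCY V₂ φ₂) :
    IsGCY (V₁ × V₂)
        (pbC (V₁ × V₂) V₁ (LinearMap.fst ℝ V₁ V₂) φ₁ *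
          pbC (V₁ × V₂) V₂ (LinearMap.snd ℝ V₁ V₂) φ₂) ∧
      typeOf (V₁ × V₂)
          (pbC (V₁ × V₂) V₁ (LinearMap.fst ℝ V₁ V₂) φ₁ *
            pbC (V₁ × V₂) V₂ (LinearMap.snd ℝ V₁ V₂) φ₂) =
        typeOf V₁ φ₁ + typeOf V₂ φ₂ := by
  have hφ₁ := h₁.ne_zero
  have hφ₂ := h₂.ne_zero
  have hne := pbC_fst_mul_pbC_snd_ne_zero hφ₁ hφ₂
  refine ⟨⟨le_antisymm (finrank_annC_le hne) ?_, ?_⟩,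
    typeOf_pbC_fst_mul_pbC_snd (exists_projSC_ne_zero hφ₁) (exists_projSC_ne_zero hφ₂)⟩
  · rw [Module.finrank_prod, ← h₁.1, ← h₂.1]
    exact finrank_annC_add_le φ₁ φ₂
  · rw [conjSC_mul, conjSC_pbC, conjSC_pbC, pairSC_pbC_mul_pbC h₁.even_finrank]
    exact pbC_fst_mul_pbC_snd_ne_zero h₁.2 h₂.2
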